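/- Let α ∈ ℝ, p ∈ ℂ, r > 0, and let u be analytic on the punctured disc {z ∈ ℂ : 0 < |z − p| < r} and satisfy u''(z) = 2u(z)³ + z·u(z) − α there. Suppose u has a simple pole at p with residue −1, i.e. (z − p)·u(z) → −1 as z → p. Then the function g(z) := u(z) + 1/(z − p) extends to a function analytic at p with g(p) = 0, g'(p) = p/6, and g''(p) = (α + 1)/2; equivalently, u(z) = −1/(z − p) + (p/6)(z − p) + ((α + 1)/4)(z − p)² + O((z − p)³) as z → p. -/

import Mathlib

open Filter Topology Set Metric

lemma pii_factor (F : ℂ → ℂ) (p : ℂ) (h : AnalyticAt ℂ F p) :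
    ∃ H : ℂ → ℂ, AnalyticAt ℂ H p ∧ ∀ z, F z = F p + (z - p) * H z := by
  refine ⟨dslope F p, ?_, fun z => ?_⟩
  · obtain ⟨q, hq⟩ := h
    exact ⟨_, hq.has_fpower_series_dslope_fslope⟩
  · have := sub_smul_dslope F p z
    rw [smul_eq_mul] at this
    rw [this]; ring

lemma pii_zero (f : ℂ → ℂ) (p : ℂ) (hc : ContinuousAt f p)
    (h : ∀ᶠ z in 𝓝[≠] p, f z = 0) : f p = 0 := by
  have h1 : Tendsto f (𝓝[≠] p) (𝓝 (f p)) := hc.tendsto.mono_left nhdsWithin_le_nhds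
  have h2 : Tendsto f (𝓝[≠] p) (𝓝 0) :=
    tendsto_const_nhds.congr' (h.mono fun z hz => hz.symm)
  exact tendsto_nhds_unique h1 h2

lemma pii_d (K : ℂ → ℂ) (p a b z : ℂ) (h : AnalyticAt ℂ K z) :
    HasDerivAt (fun z => a + (z - p) * (b + (z - p) * K z))
      (b + 2 * (z - p) * K z + (z - p) ^ 2 * deriv K z) z := by
  have hK := h.differentiableAt.hasDerivAt
  have hw := (hasDerivAt_id z).sub_const p
  have := (hw.mul ((hw.mul hK).const_add b)).const_add a
  refine this.congr_deriv ?_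
  simp
  ring

lemma pii_dd (K : ℂ → ℂ) (p b z : ℂ) (h : AnalyticAt ℂ K z) :
    HasDerivAt (fun z => b + 2 * (z - p) * K z + (z - p) ^ 2 * deriv K z)
      (2 * K z + 4 * (z - p) * deriv K z + (z - p) ^ 2 * deriv (deriv K) z) z := by
  have hK := h.differentiableAt.hasDerivAt
  have hK' := h.deriv.differentiableAt.hasDerivAt
  have hw := (hasDerivAt_id z).sub_const p
  have := (((hw.const_mul 2).mul hK).const_add b).add ((hw.pow 2).mul hK')
  refine this.congr_deriv ?_
  simp
  ring

/-- if `u` is analytic on the punctured disc of radius `r`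
around `p`, solves `u'' = 2 u^3 + z u - α` there, and has a simple pole at
`p` with residue `-1`, then `g(z) = u(z) + 1/(z-p)` extends analytically to
`p` with `g(p) = 0`, `g'(p) = p/6` and `g''(p) = (α+1)/2`. -/
theorem pii_laurent_residue_minus_one (α : ℝ) (p : ℂ) (r : ℝ) (hr : 0 < r)
    (u : ℂ → ℂ) (hu : AnalyticOnNhd ℂ u (ball p r \ {p}))
    (hPII : ∀ z ∈ ball p r \ {p},
      deriv (deriv u) z = 2 * (u z) ^ 3 + z * u z - (α : ℂ))
    (hpole : Tendsto (fun z => (z - p) * u z) (𝓝[≠] p) (𝓝 (-1))) :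
    ∃ G : ℂ → ℂ, AnalyticAt ℂ G p ∧
      (∀ᶠ z in 𝓝[≠] p, G z = u z + 1 / (z - p)) ∧
      G p = 0 ∧ deriv G p = p / 6 ∧
      deriv (deriv G) p = ((α : ℂ) + 1) / 2 := by
  have hev : ∀ᶠ z in 𝓝[≠] p, z ∈ ball p r \ {p} := by
    filter_upwards [self_mem_nhdsWithin, nhdsWithin_le_nhds (ball_mem_nhds p hr)] with z h1 h2
    exact ⟨h2, h1⟩
  have hF : AnalyticAt ℂ (Function.update (fun z => (z - p) * u z) p (-1)) p := by
    apply Complex.analyticAt_of_differentiable_on_punctured_nhds_of_continuousAt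
    · filter_upwards [hev] with z hz
      have h1 : DifferentiableAt ℂ (fun z => (z - p) * u z) z :=
        (differentiableAt_id.sub_const p).mul (hu z hz).differentiableAt
      apply h1.congr_of_eventuallyEq
      filter_upwards [isOpen_ne.mem_nhds hz.2] with y hy
      exact Function.update_of_ne hy _ _
    · exact continuousAt_update_same.2 hpole
  obtain ⟨G, hG, hFG⟩ := pii_factor _ p hF
  obtain ⟨H, hH, hGH⟩ := pii_factor _ p hG
  obtain ⟨K, hK, hHK⟩ := pii_factor _ p hH
  have hGu : ∀ z, z ≠ p → u z = -(z - p)⁻¹ + G z := by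
    intro z hz
    have h1 := hFG z
    rw [Function.update_of_ne hz, Function.update_self] at h1
    have h2 : z - p ≠ 0 := sub_ne_zero.2 hz
    apply mul_left_cancel₀ h2
    rw [h1]; field_simp
  generalize G p = a at hGH
  generalize H p = b at hHK
  obtain rfl : G = fun z => a + (z - p) * (b + (z - p) * K z) := by
    funext z; rw [hGH, hHK]
  beta_reduce at hGu
  have hevK : ∀ᶠ z in 𝓝 p, AnalyticAt ℂ K z := hK.eventually_analyticAt
  have hdG : deriv (fun z => a + (z - p) * (b + (z - p) * K z)) =ᶠ[𝓝 p]
      fun z => b + 2 * (z - p) * K z + (z - p) ^ 2 * deriv K z := by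
    filter_upwards [hevK] with z hz using (pii_d K p a b z hz).deriv
  have hode : ∀ᶠ z in 𝓝[≠] p,
      (z - p) ^ 2 * (2 * K z + 4 * (z - p) * deriv K z + (z - p) ^ 2 * deriv (deriv K) z)
      = 6 * (a + (z - p) * (b + (z - p) * K z))
        - 6 * (z - p) * (a + (z - p) * (b + (z - p) * K z)) ^ 2
        + 2 * (z - p) ^ 2 * (a + (z - p) * (b + (z - p) * K z)) ^ 3
        + (p + (z - p)) * (-(z - p) + (z - p) ^ 2 * (a + (z - p) * (b + (z - p) * K z)))
        - α * (z - p) ^ 2 := by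
    filter_upwards [hev, nhdsWithin_le_nhds hevK.eventually_nhds] with z hz hKz
    have hzp : z ≠ p := hz.2
    have hw : z - p ≠ 0 := sub_ne_zero.2 hzp
    have hne : ∀ᶠ y in 𝓝 z, y ≠ p := isOpen_ne.mem_nhds hzp
    have hu1 : deriv u =ᶠ[𝓝 z] fun y => ((y - p) ^ 2)⁻¹ +
        (b + 2 * (y - p) * K y + (y - p) ^ 2 * deriv K y) := by
      filter_upwards [hne.eventually_nhds, hKz] with y hy hKy
      have hy0 : y - p ≠ 0 := sub_ne_zero.2 hy.self_of_nhds
      have e : u =ᶠ[𝓝 y] fun z => -(z - p)⁻¹ + (a + (z - p) * (b + (z - p) * K z)) := by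
        filter_upwards [hy] with x hx using hGu x hx
      rw [e.deriv_eq]
      have := ((((hasDerivAt_id y).sub_const p).inv hy0).neg).add (pii_d K p a b y hKy)
      refine HasDerivAt.deriv ?_
      refine this.congr_deriv ?_
      simp
      ring
    have hu2 : deriv (deriv u) z = -2 / (z - p) ^ 3 + (2 * K z + 4 * (z - p) * deriv K z
        + (z - p) ^ 2 * deriv (deriv K) z) := by
      rw [hu1.deriv_eq]
      have := ((((hasDerivAt_id z).sub_const p).pow 2).inv (pow_ne_zero 2 hw)).add
        (pii_dd K p b z hKz.self_of_nhds)
      refine HasDerivAt.deriv ?_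
      refine this.congr_deriv ?_
      simp
      field_simp
    have h := hPII z hz
    rw [hu2, hGu z hzp] at h
    generalize deriv (deriv K) z = K2 at *
    generalize deriv K z = K1 at *
    generalize K z = K0 at *
    obtain ⟨w, rfl⟩ : ∃ w, z = p + w := ⟨z - p, by ring⟩
    simp only [add_sub_cancel_left] at *
    field_simp at h
    apply mul_left_cancel₀ hw
    linear_combination h
  have cK := hK.continuousAt
  have cK1 := hK.deriv.continuousAt
  have cK2 := hK.deriv.deriv.continuousAt
  have ha : a = 0 := by
    have := pii_zero (fun z => (z - p) ^ 2 * (2 * K z + 4 * (z - p) * deriv K z + (z - p) ^ 2 * deriv (deriv K) z)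
      - (6 * (a + (z - p) * (b + (z - p) * K z))
        - 6 * (z - p) * (a + (z - p) * (b + (z - p) * K z)) ^ 2
        + 2 * (z - p) ^ 2 * (a + (z - p) * (b + (z - p) * K z)) ^ 3
        + (p + (z - p)) * (-(z - p) + (z - p) ^ 2 * (a + (z - p) * (b + (z - p) * K z)))
        - α * (z - p) ^ 2)) p (by fun_prop) (hode.mono fun z hz => sub_eq_zero.2 hz)
    simpa using this
  subst ha
  have hb : b = p / 6 := by
    have := pii_zero (fun z => (z - p) * (2 * K z + 4 * (z - p) * deriv K z + (z - p) ^ 2 * deriv (deriv K) z)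
      - (6 * (b + (z - p) * K z)
        - 6 * (z - p) ^ 2 * (b + (z - p) * K z) ^ 2
        + 2 * (z - p) ^ 4 * (b + (z - p) * K z) ^ 3
        + (p + (z - p)) * (-1 + (z - p) ^ 2 * (b + (z - p) * K z))
        - α * (z - p))) p (by fun_prop) (by
          filter_upwards [hode, self_mem_nhdsWithin] with z hz hzp
          have hw : z - p ≠ 0 := sub_ne_zero.2 hzp
          apply mul_left_cancel₀ hw
          linear_combination hz)
    simp at this
    linear_combination -this / 6
  have hk : K p = (α + 1) / 4 := by
    have := pii_zero (fun z => (2 * K z + 4 * (z - p) * deriv K z + (z - p) ^ 2 * deriv (deriv K) z)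
      - (6 * K z
        - 6 * (z - p) * (b + (z - p) * K z) ^ 2
        + 2 * (z - p) ^ 3 * (b + (z - p) * K z) ^ 3
        - 1 + (p + (z - p)) * (z - p) * (b + (z - p) * K z)
        - α)) p (by fun_prop) (by
          filter_upwards [hode, self_mem_nhdsWithin] with z hz hzp
          have hw : z - p ≠ 0 := sub_ne_zero.2 hzp
          apply mul_left_cancel₀ (pow_ne_zero 2 hw)
          linear_combination hz + 6 * (z - p) * hb)
    simp at this
    linear_combination -this / 4
  refine ⟨_, hG, ?_, by simp, ?_, ?_⟩
  · filter_upwards [self_mem_nhdsWithin] with z hz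
    rw [hGu z hz]; simp
  · rw [hdG.self_of_nhds]; simp [hb]
  · rw [hdG.deriv_eq, (pii_dd K p b p hK).deriv, hk]
    simp; ring
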